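/- arXiv:1003.4766 — 3 statements merged into one kernel-verified Lean document; each statement's English description precedes it below -/
import Mathlib

section
/- Let 𝒞 be a preadditive category with binary biproducts, and let X be a ℤ-indexed cochain complex in 𝒞 such that for some degree n we have X^n = b₁ ⊞ D and X^{n+1} = b₂ ⊞ E for objects b₁, D, b₂, E of 𝒞. Write the differential d^{n-1} : X^{n-1} → b₁ ⊞ D in components as (α, β) with α : X^{n-1} → b₁ and β : X^{n-1} → D, write d^n : b₁ ⊞ D → b₂ ⊞ E in matrix components as φ : b₁ → b₂, δ : D → b₂, γ : b₁ → E, ε : D → E, and write d^{n+1} : b₂ ⊞ E → X^{n+2} in components as (μ, ν) with μ : b₂ → X^{n+2} and ν : E → X^{n+2}. Assume φ is an isomorphism. Then X is isomorphic (as a cochain complex) to the cochain complex X' which agrees with X in all degrees and in all differentials except that d'^{n-1} has components (0, β), d'^n is the diagonal (direct-sum) morphism with components φ : b₁ → b₂ and ε − γ ∘ φ⁻¹ ∘ δ : D → E and zero off-diagonal components, and d'^{n+1} has components (0, ν). -/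
open CategoryTheory CategoryTheory.Limits

/-- The complex obtained from `X` by transporting its differentials along automorphisms `e` of
its terms. -/
@[simps] def HomologicalComplex.conj {V ι : Type*} [Category* V] [HasZeroMorphisms V]
    {c : ComplexShape ι} (X : HomologicalComplex V c) (e : ∀ i, X.X i ≅ X.X i) :
    HomologicalComplex V c where
  X := X.X
  d i j := (e i).inv ≫ X.d i j ≫ (e j).hom
  shape i j h := by simp [X.shape i j h]
  d_comp_d' i j k _ _ := by simp

/-- Transporting the differentials along automorphisms of the terms gives an isomorphic
complex. -/
def HomologicalComplex.isoConj {V ι : Type*} [Category* V] [HasZeroMorphisms V]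
    {c : ComplexShape ι} (X : HomologicalComplex V c) (e : ∀ i, X.X i ≅ X.X i) :
    X ≅ X.conj e :=
  HomologicalComplex.Hom.isoOfComponents e (fun i _ _ => (e i).hom_inv_id_assoc _)

section Shear

variable {C : Type*} [Category C] [Preadditive C] [HasBinaryBiproducts C]

lemma lift_comp_unipotentLower {W X Y : C} (f : W ⟶ X) (g : W ⟶ Y) (r : Y ⟶ X) :
    biprod.lift f g ≫ (Biprod.unipotentLower r).hom = biprod.lift (f + g ≫ r) g := by
  ext <;> simp [Biprod.ofComponents]

lemma unipotentUpper_inv_comp_desc {W X Y : C} (f : X ⟶ W) (g : Y ⟶ W) (r : X ⟶ Y) :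
    (Biprod.unipotentUpper r).inv ≫ biprod.desc f g = biprod.desc (f - r ≫ g) g := by
  ext <;> simp [Biprod.ofComponents, sub_eq_add_neg]

/-- Block diagonalization of a matrix whose upper left entry is invertible. -/
lemma shear_comp_matrix_comp_shear {b₁ D b₂ E : C} (φ : b₁ ⟶ b₂) [IsIso φ] (δ : D ⟶ b₂)
    (γ : b₁ ⟶ E) (ε : D ⟶ E) :
    (Biprod.unipotentLower (δ ≫ inv φ)).inv ≫
        biprod.lift (biprod.desc φ δ) (biprod.desc γ ε) ≫
        (Biprod.unipotentUpper (-(inv φ ≫ γ))).hom =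
      biprod.map φ (ε - δ ≫ inv φ ≫ γ) := by
  ext <;> simp [Biprod.ofComponents, sub_eq_add_neg, add_comm]

end Shear

/-- **Gaussian elimination, isomorphism form** (Bar-Natan, Lemma 4.2; Lemma 2.2 of the paper).
Let `X` be a `ℤ`-indexed cochain complex in a preadditive category with binary biproducts,
with `X^n = b₁ ⊞ D` and `X^{n+1} = b₂ ⊞ E`, differentials `d^{n-1}` with components `(α, β)`,
`d^n` with matrix components `φ, δ, γ, ε`, and `d^{n+1}` with components `(μ, ν)`, where `φ`
is an isomorphism.  Then `X` is isomorphic to the complex `Y` agreeing with `X` in all degrees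
and all differentials, except that `d'^{n-1} = (0, β)`, `d'^n` is the diagonal morphism with
components `φ` and `ε - γ ∘ φ⁻¹ ∘ δ`, and `d'^{n+1} = (0, ν)`. -/
theorem gaussian_elimination_isomorphism
    {𝒞 : Type*} [Category 𝒞] [Preadditive 𝒞] [HasBinaryBiproducts 𝒞]
    (X : CochainComplex 𝒞 ℤ) (n : ℤ) (b₁ D b₂ E : 𝒞)
    (hn : X.X n = (b₁ ⊞ D)) (hn1 : X.X (n + 1) = (b₂ ⊞ E))
    (α : X.X (n - 1) ⟶ b₁) (β : X.X (n - 1) ⟶ D)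
    (φ : b₁ ⟶ b₂) (δ : D ⟶ b₂) (γ : b₁ ⟶ E) (ε : D ⟶ E)
    (μ : b₂ ⟶ X.X (n + 2)) (ν : E ⟶ X.X (n + 2))
    (hd₁ : X.d (n - 1) n = biprod.lift α β ≫ eqToHom hn.symm)
    (hd₂ : X.d n (n + 1) =
      eqToHom hn ≫ biprod.lift (biprod.desc φ δ) (biprod.desc γ ε) ≫ eqToHom hn1.symm)
    (hd₃ : X.d (n + 1) (n + 2) = eqToHom hn1 ≫ biprod.desc μ ν)
    [IsIso φ] :
    ∃ (Y : CochainComplex 𝒞 ℤ) (hY : ∀ k : ℤ, Y.X k = X.X k),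
      (∀ k : ℤ, k ≠ n - 1 → k ≠ n → k ≠ n + 1 →
        Y.d k (k + 1) = eqToHom (hY k) ≫ X.d k (k + 1) ≫ eqToHom (hY (k + 1)).symm) ∧
      Y.d (n - 1) n =
        eqToHom (hY (n - 1)) ≫ biprod.lift (0 : X.X (n - 1) ⟶ b₁) β ≫
          eqToHom hn.symm ≫ eqToHom (hY n).symm ∧
      Y.d n (n + 1) =
        eqToHom (hY n) ≫ eqToHom hn ≫ biprod.map φ (ε - δ ≫ inv φ ≫ γ) ≫
          eqToHom hn1.symm ≫ eqToHom (hY (n + 1)).symm ∧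
      Y.d (n + 1) (n + 2) =
        eqToHom (hY (n + 1)) ≫ eqToHom hn1 ≫ biprod.desc (0 : b₂ ⟶ X.X (n + 2)) ν ≫
          eqToHom (hY (n + 2)).symm ∧
      Nonempty (X ≅ Y) := by
  have hαβ : α + β ≫ δ ≫ inv φ = 0 := by
    have h := X.d_comp_d (n - 1) n (n + 1)
    rw [hd₁, hd₂] at h
    have h' := h =≫ (eqToHom hn1 ≫ biprod.fst ≫ inv φ)
    simpa [biprod.lift_desc_assoc] using h'
  have hμν : μ + inv φ ≫ γ ≫ ν = 0 := by
    have h := X.d_comp_d n (n + 1) (n + 2)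
    rw [hd₂, hd₃] at h
    have h' := (inv φ ≫ biprod.inl ≫ eqToHom hn.symm) ≫= h
    simpa [biprod.lift_desc] using h'
  let e₀ : X.X n ≅ X.X n :=
    eqToIso hn ≪≫ Biprod.unipotentLower (δ ≫ inv φ) ≪≫ eqToIso hn.symm
  let e₁ : X.X (n + 1) ≅ X.X (n + 1) :=
    eqToIso hn1 ≪≫ Biprod.unipotentUpper (-(inv φ ≫ γ)) ≪≫ eqToIso hn1.symm
  let e : ∀ k, X.X k ≅ X.X k :=
    Function.update (Function.update (fun k => Iso.refl (X.X k)) n e₀) (n + 1) e₁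
  have he₀ : e n = e₀ := by simp [e]
  have he₁ : e (n + 1) = e₁ := by simp [e]
  have he : ∀ k, k ≠ n → k ≠ n + 1 → e k = Iso.refl _ := fun k h h' => by simp [e, h, h']
  refine ⟨X.conj e, fun _ => rfl, fun k h h' h'' => ?_, ?_, ?_, ?_, ⟨X.isoConj e⟩⟩
  · change _ = 𝟙 _ ≫ X.d k (k + 1) ≫ 𝟙 _
    simp [he k h' h'', he (k + 1) (by omega) (by omega)]
  · change _ = 𝟙 _ ≫ biprod.lift 0 β ≫ eqToHom hn.symm ≫ 𝟙 _
    simp [he (n - 1) (by omega) (by omega), he₀, e₀, hd₁, reassoc_of% lift_comp_unipotentLower,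
      hαβ, -Biprod.unipotentLower_hom]
  · change _ = 𝟙 _ ≫ eqToHom hn ≫ biprod.map φ (ε - δ ≫ inv φ ≫ γ) ≫ eqToHom hn1.symm ≫ 𝟙 _
    simp [he₀, he₁, e₀, e₁, hd₂, ← shear_comp_matrix_comp_shear]
  · change _ = 𝟙 _ ≫ eqToHom hn1 ≫ biprod.desc 0 ν ≫ 𝟙 _
    simp [he (n + 2) (by omega) (by omega), he₁, e₁, hd₃, unipotentUpper_inv_comp_desc, hμν,
      -Biprod.unipotentUpper_inv]
end

section
/- Let 𝒞 be a preadditive category with binary biproducts, and let X be a ℤ-indexed cochain complex in 𝒞 such that for some degree n we have X^n = b₁ ⊞ D and X^{n+1} = b₂ ⊞ E for objects b₁, D, b₂, E of 𝒞. Write the differential d^{n-1} : X^{n-1} → b₁ ⊞ D in components as (α, β), write d^n : b₁ ⊞ D → b₂ ⊞ E in matrix components as φ : b₁ → b₂, δ : D → b₂, γ : b₁ → E, ε : D → E, and write d^{n+1} : b₂ ⊞ E → X^{n+2} in components as (μ, ν). Assume φ is an isomorphism. Then X is homotopy equivalent to the cochain complex Y defined by Y^n = D, Y^{n+1} = E,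 Y^k = X^k for all k ∉ {n, n+1}, with differentials d_Y^{n-1} = β : X^{n-1} → D, d_Y^n = ε − γ ∘ φ⁻¹ ∘ δ : D → E, d_Y^{n+1} = ν : E → X^{n+2}, and d_Y^k = d_X^k for all other k. -/
open CategoryTheory CategoryTheory.Limits

namespace HomologicalComplex

variable {C ι : Type*} [Category C] [Preadditive C] {c : ComplexShape ι}
  {X : HomologicalComplex C c}

/-- The complex on degreewise retracts of `X` whose associated idempotents form a chain map `p`. -/
def ofRetracts (p : X ⟶ X) {Y : ι → C} (R : ∀ i, Retract (Y i) (X.X i))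
    (hp : ∀ i, (R i).r ≫ (R i).i = p.f i) : HomologicalComplex C c where
  X := Y
  d i j := (R i).i ≫ X.d i j ≫ (R j).r
  shape i j hij := by rw [X.shape i j hij, zero_comp, comp_zero]
  d_comp_d' i j k _ _ := by
    simp [reassoc_of% hp j]

/-- If the idempotent chain map `p` is homotopic to the identity, then the complex of retracts
it determines is homotopy equivalent to `X`. -/
def homotopyEquivOfRetracts (p : X ⟶ X) {Y : ι → C} (R : ∀ i, Retract (Y i) (X.X i))
    (hp : ∀ i, (R i).r ≫ (R i).i = p.f i) (h : Homotopy p (𝟙 X)) :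
    HomotopyEquiv X (ofRetracts p R hp) where
  hom :=
    { f := fun i => (R i).r
      comm' := fun i j _ => by
        change (R i).r ≫ (R i).i ≫ X.d i j ≫ (R j).r = X.d i j ≫ (R j).r
        rw [reassoc_of% hp i, p.comm_assoc, ← hp j, Category.assoc, Retract.retract,
          Category.comp_id] }
  inv :=
    { f := fun i => (R i).i
      comm' := fun i j _ => by
        change (R i).i ≫ X.d i j = ((R i).i ≫ X.d i j ≫ (R j).r) ≫ (R j).i
        rw [Category.assoc, Category.assoc, hp j, ← p.comm, ← hp i, Category.assoc,
          Retract.retract_assoc] }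
  homotopyHomInvId := (Homotopy.ofEq (by ext i; exact hp i)).trans h
  homotopyInvHomId := Homotopy.ofEq (by ext i; exact (R i).retract)

end HomologicalComplex

namespace CategoryTheory

variable {C : Type*} [Category C]

lemma Retract.i_comp_comp_r_of_eq {U V : C} {P : Σ A, Retract A U} {Q : Σ B, Retract B V}
    {A B : C} {r : Retract A U} {s : Retract B V} (hP : P = ⟨A, r⟩) (hQ : Q = ⟨B, s⟩)
    (f : U ⟶ V) :
    P.2.i ≫ f ≫ Q.2.r = eqToHom (congrArg Sigma.fst hP) ≫ (r.i ≫ f ≫ s.r) ≫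
      eqToHom (congrArg Sigma.fst hQ).symm := by
  subst hP hQ
  simp

variable [Preadditive C] [HasBinaryBiproducts C]

/-- The graph of `-f`, as a retract of the biproduct along the second projection. -/
@[simps]
noncomputable def Retract.biprodSnd {A B : C} (f : B ⟶ A) : Retract B (A ⊞ B) where
  i := biprod.lift (-f) (𝟙 B)
  r := biprod.snd

/-- The second summand, as a retract of the biproduct along a projection with component `-f`
on the first summand. -/
@[simps]
noncomputable def Retract.biprodInr {A B : C} (f : A ⟶ B) : Retract B (A ⊞ B) where
  i := biprod.inr
  r := biprod.desc (-f) (𝟙 B)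

end CategoryTheory

/-- **Gaussian elimination, homotopy-equivalence form** (Bar-Natan, Lemma 4.2; Lemma 2.2 of the
paper).  Let `X` be a `ℤ`-indexed cochain complex in a preadditive category with binary
biproducts, with `X^n = b₁ ⊞ D` and `X^{n+1} = b₂ ⊞ E`, differentials `d^{n-1}` with
components `(α, β)`, `d^n` with matrix components `φ, δ, γ, ε`, and `d^{n+1}` with components
`(μ, ν)`, where `φ` is an isomorphism.  Then `X` is homotopy equivalent to the complex `Y`
with `Y^n = D`, `Y^{n+1} = E`, agreeing with `X` in all other degrees, with differentials
`d_Y^{n-1} = β`, `d_Y^n = ε - γ ∘ φ⁻¹ ∘ δ`, `d_Y^{n+1} = ν`, and `d_Y^k = d_X^k` otherwise. -/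
theorem gaussian_elimination_homotopyEquiv
    {𝒞 : Type*} [Category 𝒞] [Preadditive 𝒞] [HasBinaryBiproducts 𝒞]
    (X : CochainComplex 𝒞 ℤ) (n : ℤ) (b₁ D b₂ E : 𝒞)
    (hn : X.X n = (b₁ ⊞ D)) (hn1 : X.X (n + 1) = (b₂ ⊞ E))
    (α : X.X (n - 1) ⟶ b₁) (β : X.X (n - 1) ⟶ D)
    (φ : b₁ ⟶ b₂) (δ : D ⟶ b₂) (γ : b₁ ⟶ E) (ε : D ⟶ E)
    (μ : b₂ ⟶ X.X (n + 2)) (ν : E ⟶ X.X (n + 2))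
    (hd₁ : X.d (n - 1) n = biprod.lift α β ≫ eqToHom hn.symm)
    (hd₂ : X.d n (n + 1) =
      eqToHom hn ≫ biprod.lift (biprod.desc φ δ) (biprod.desc γ ε) ≫ eqToHom hn1.symm)
    (hd₃ : X.d (n + 1) (n + 2) = eqToHom hn1 ≫ biprod.desc μ ν)
    [IsIso φ] :
    ∃ (Y : CochainComplex 𝒞 ℤ) (hYn : Y.X n = D) (hYn1 : Y.X (n + 1) = E)
      (hY : ∀ k : ℤ, k ≠ n → k ≠ n + 1 → Y.X k = X.X k),
      (∀ (k : ℤ) (h₁ : k ≠ n - 1) (h₂ : k ≠ n) (h₃ : k ≠ n + 1),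
        Y.d k (k + 1) = eqToHom (hY k h₂ h₃) ≫ X.d k (k + 1) ≫
          eqToHom (hY (k + 1) (by omega) (by omega)).symm) ∧
      Y.d (n - 1) n =
        eqToHom (hY (n - 1) (by omega) (by omega)) ≫ β ≫ eqToHom hYn.symm ∧
      Y.d n (n + 1) = eqToHom hYn ≫ (ε - δ ≫ inv φ ≫ γ) ≫ eqToHom hYn1.symm ∧
      Y.d (n + 1) (n + 2) =
        eqToHom hYn1 ≫ ν ≫ eqToHom (hY (n + 2) (by omega) (by omega)).symm ∧
      Nonempty (HomotopyEquiv X Y) := by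
  let rn : Retract D (X.X n) :=
    (Retract.biprodSnd (δ ≫ inv φ)).trans (Retract.ofIso (eqToIso hn.symm))
  let rn1 : Retract E (X.X (n + 1)) :=
    (Retract.biprodInr (inv φ ≫ γ)).trans (Retract.ofIso (eqToIso hn1.symm))
  let P : ∀ k, Σ A, Retract A (X.X k) :=
    Function.update (Function.update (fun k => ⟨X.X k, Retract.refl _⟩) n ⟨D, rn⟩)
      (n + 1) ⟨E, rn1⟩
  have hPn : P n = ⟨D, rn⟩ := by simp [P]
  have hPn1 : P (n + 1) = ⟨E, rn1⟩ := by simp [P]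
  have hP : ∀ k, k ≠ n → k ≠ n + 1 → P k = ⟨X.X k, Retract.refl _⟩ := by
    intro k h₁ h₂
    simp [P, h₁, h₂]
  let h₀ : X.X (n + 1) ⟶ X.X n :=
    eqToHom hn1 ≫ biprod.fst ≫ inv φ ≫ biprod.inl ≫ eqToHom hn.symm
  let h : ∀ i j, (ComplexShape.up ℤ).Rel j i → (X.X i ⟶ X.X j) := fun i j hij =>
    if hj : j = n then
      eqToHom (by rw [← hij, hj]) ≫ h₀ ≫ eqToHom (by rw [hj])
    else 0
  have h_self : h (n + 1) n rfl = h₀ := by simp [h]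
  have h_zero : ∀ i j hij, j ≠ n → h i j hij = 0 := fun i j hij hj => dif_neg hj
  let p : X ⟶ X := 𝟙 X - Homotopy.nullHomotopicMap' h
  have hpf : ∀ k, p.f k = 𝟙 _ - (X.d k (k + 1) ≫ h (k + 1) k rfl +
      h k (k - 1) (sub_add_cancel k 1) ≫ X.d (k - 1) k) := by
    intro k
    simp only [p, HomologicalComplex.sub_f_apply, HomologicalComplex.id_f]
    rw [Homotopy.nullHomotopicMap'_f (sub_add_cancel k 1) rfl]
  have hp : ∀ k, (P k).2.r ≫ (P k).2.i = p.f k := by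
    intro k
    rw [hpf]
    by_cases hk : k = n
    · subst hk
      rw [hPn, h_self, h_zero k (k - 1) (sub_add_cancel k 1) (by omega), hd₂]
      have key : biprod.snd ≫ biprod.lift (-(δ ≫ inv φ)) (𝟙 D) =
          𝟙 (b₁ ⊞ D) - biprod.desc φ δ ≫ inv φ ≫ biprod.inl := by
        ext <;> simp
      have := eqToHom hn ≫= key =≫ eqToHom hn.symm
      simpa [rn, h₀, Retract.ofIso] using this
    · by_cases hk1 : k = n + 1
      · subst hk1
        have key : biprod.desc (-(inv φ ≫ γ)) (𝟙 E) ≫ biprod.inr =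
            𝟙 (b₂ ⊞ E) - biprod.fst ≫ inv φ ≫ biprod.inl ≫
              biprod.lift (biprod.desc φ δ) (biprod.desc γ ε) := by
          ext <;> simp
        have hh : h (n + 1) (n + 1 - 1) (sub_add_cancel _ 1) ≫ X.d (n + 1 - 1) (n + 1) =
            h₀ ≫ X.d n (n + 1) := by
          rw [← h_self]
          congr! <;> omega
        rw [hPn1, h_zero (n + 1 + 1) (n + 1) rfl (by omega), hh, hd₂]
        have := eqToHom hn1 ≫= key =≫ eqToHom hn1.symm
        simpa [rn1, h₀, Retract.ofIso] using this
      · rw [hP k hk hk1, h_zero (k + 1) k rfl hk, h_zero k (k - 1) (sub_add_cancel k 1) (by omega)]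
        simp
  let H : Homotopy p (𝟙 X) :=
    (Homotopy.equivSubZero.symm ((Homotopy.ofEq (by simp [p])).trans
      (Homotopy.nullHomotopy' h))).symm
  refine ⟨HomologicalComplex.ofRetracts p (fun k => (P k).2) hp, congrArg Sigma.fst hPn,
    congrArg Sigma.fst hPn1, fun k h₁ h₂ => congrArg Sigma.fst (hP k h₁ h₂), ?_, ?_, ?_, ?_,
    ⟨HomologicalComplex.homotopyEquivOfRetracts p _ hp H⟩⟩
  · intro k h₁ h₂ h₃
    refine (Retract.i_comp_comp_r_of_eq (hP k h₂ h₃)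
      (hP (k + 1) (by omega) (by omega)) _).trans ?_
    simp only [Retract.refl, Category.id_comp, Category.comp_id]
    rfl
  · refine (Retract.i_comp_comp_r_of_eq (hP (n - 1) (by omega) (by omega)) hPn _).trans ?_
    rw [show (Retract.refl _).i ≫ X.d (n - 1) n ≫ rn.r = β by
      simp [rn, hd₁, Retract.ofIso]]
    rfl
  · refine (Retract.i_comp_comp_r_of_eq hPn hPn1 _).trans ?_
    have key : biprod.lift (-(δ ≫ inv φ)) (𝟙 D) ≫
        biprod.lift (biprod.desc φ δ) (biprod.desc γ ε) ≫
          biprod.desc (-(inv φ ≫ γ)) (𝟙 E) = ε - δ ≫ inv φ ≫ γ := by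
      simp [biprod.lift_desc]
      abel
    rw [show rn.i ≫ X.d n (n + 1) ≫ rn1.r = ε - δ ≫ inv φ ≫ γ by
      rw [← key]
      simp [rn, rn1, hd₂, Retract.ofIso]]
    rfl
  · refine (Retract.i_comp_comp_r_of_eq hPn1 (hP (n + 2) (by omega) (by omega)) _).trans ?_
    rw [show rn1.i ≫ X.d (n + 1) (n + 2) ≫ (Retract.refl _).r = ν by
      simp [rn1, hd₃, Retract.ofIso]]
    rfl
end

section
/- Let 𝒞 be a preadditive category with binary biproducts. Consider objects C, b₁, b₂ of 𝒞, objects D = D₁ ⊞ D₂, E = E₁ ⊞ E₂, and F of 𝒞, and a four-term cochain complex segment C → (b₁ ⊞ D) → (b₂ ⊞ E) → F with consecutive composites zero, whose middle differential has matrix components φ : b₁ → b₂, δ : D → b₂, γ : b₁ → E, ε : D → E with φ an isomorphism. Assume all three differentials are block-lower-triangular in the following sense: the component of δ on the summand D₂ is zero (δ = (δ₁, 0) with δ₁ : D₁ → b₂), the component of ε from D₂ to E₁ is zero (ε has blocks ε₁ : D₁ → E₁, 0 : D₂ → E₁, ε₂ : D₁ → E₂, ε₃ : D₂ → E₂), the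 first differential C → b₁ ⊞ D has components (α, β), and the last differential b₂ ⊞ E → F has components (μ, ν). Then after Gaussian elimination on φ, the resulting three-term segment C →β D →(ε − γ∘φ⁻¹∘δ) E →ν F again has consecutive composites zero, its middle differential ε − γ∘φ⁻¹∘δ has zero component from D₂ to E₁, and its component from D₂ to E₂ equals ε₃; moreover the four-term segment is homotopy equivalent (as part of the ambient complexes, extended by zero) to the three-term reduced segment. -/
open CategoryTheory CategoryTheory.Limits

namespace FourTermComplex

section

variable {𝒞 : Type*} [Category 𝒞]

open scoped ZeroObject

/-- The objects of a four-term segment in degrees `0, 1, 2, 3`, extended by zero. -/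
noncomputable def X [HasZeroObject 𝒞] (A₀ A₁ A₂ A₃ : 𝒞) : ℤ → 𝒞
  | 0 => A₀
  | 1 => A₁
  | 2 => A₂
  | 3 => A₃
  | _ => 0

lemma isZero_X [HasZeroObject 𝒞] (A₀ A₁ A₂ A₃ : 𝒞) (k : ℤ) (h₀ : k ≠ 0) (h₁ : k ≠ 1) (h₂ : k ≠ 2)
    (h₃ : k ≠ 3) :
    IsZero (X A₀ A₁ A₂ A₃ k) := by
  unfold X
  split <;> first | contradiction | exact isZero_zero 𝒞

variable [Preadditive 𝒞] [HasZeroObject 𝒞] {A₀ A₁ A₂ A₃ B₀ B₁ B₂ B₃ : 𝒞}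

/-- The differentials of a four-term segment extended by zero. -/
noncomputable def d (a₀ : A₀ ⟶ A₁) (a₁ : A₁ ⟶ A₂) (a₂ : A₂ ⟶ A₃) :
    ∀ n : ℤ, X A₀ A₁ A₂ A₃ n ⟶ X A₀ A₁ A₂ A₃ (n + 1)
  | 0 => a₀
  | 1 => a₁
  | 2 => a₂
  | _ => 0

/-- A degreewise family of morphisms between four-term segments extended by zero. -/
noncomputable def f (f₀ : A₀ ⟶ B₀) (f₁ : A₁ ⟶ B₁) (f₂ : A₂ ⟶ B₂) (f₃ : A₃ ⟶ B₃) :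
    ∀ n : ℤ, X A₀ A₁ A₂ A₃ n ⟶ X B₀ B₁ B₂ B₃ n
  | 0 => f₀
  | 1 => f₁
  | 2 => f₂
  | 3 => f₃
  | _ => 0

lemma d_comp_d {a₀ : A₀ ⟶ A₁} {a₁ : A₁ ⟶ A₂} {a₂ : A₂ ⟶ A₃}
    (h₀ : a₀ ≫ a₁ = 0) (h₁ : a₁ ≫ a₂ = 0) (n : ℤ) :
    d a₀ a₁ a₂ n ≫ d a₀ a₁ a₂ (n + 1) = 0 := by
  by_cases n0 : n = 0
  · subst n0; exact h₀
  by_cases n1 : n = 1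
  · subst n1; exact h₁
  by_cases n2 : n = 2
  · subst n2; exact comp_zero
  by_cases n3 : n = 3
  · subst n3; exact zero_comp
  · exact (isZero_X _ _ _ _ n n0 n1 n2 n3).eq_of_src _ _

/-- A four-term segment extended by zero to a cochain complex. -/
noncomputable def complex (a₀ : A₀ ⟶ A₁) (a₁ : A₁ ⟶ A₂) (a₂ : A₂ ⟶ A₃)
    (h₀ : a₀ ≫ a₁ = 0) (h₁ : a₁ ≫ a₂ = 0) : CochainComplex 𝒞 ℤ :=
  CochainComplex.of (X A₀ A₁ A₂ A₃) (d a₀ a₁ a₂) (d_comp_d h₀ h₁)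

section

variable {a₀ : A₀ ⟶ A₁} {a₁ : A₁ ⟶ A₂} {a₂ : A₂ ⟶ A₃} {ha₀ : a₀ ≫ a₁ = 0} {ha₁ : a₁ ≫ a₂ = 0}
  {b₀ : B₀ ⟶ B₁} {b₁ : B₁ ⟶ B₂} {b₂ : B₂ ⟶ B₃} {hb₀ : b₀ ≫ b₁ = 0} {hb₁ : b₁ ≫ b₂ = 0}

lemma complex_d (n : ℤ) : (complex a₀ a₁ a₂ ha₀ ha₁).d n (n + 1) = d a₀ a₁ a₂ n :=
  CochainComplex.of_d _ _ _

/-- A morphism of four-term segments extended by zero. -/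
noncomputable def hom (f₀ : A₀ ⟶ B₀) (f₁ : A₁ ⟶ B₁) (f₂ : A₂ ⟶ B₂) (f₃ : A₃ ⟶ B₃)
    (c₀ : f₀ ≫ b₀ = a₀ ≫ f₁) (c₁ : f₁ ≫ b₁ = a₁ ≫ f₂) (c₂ : f₂ ≫ b₂ = a₂ ≫ f₃) :
    complex a₀ a₁ a₂ ha₀ ha₁ ⟶ complex b₀ b₁ b₂ hb₀ hb₁ where
  f := f f₀ f₁ f₂ f₃
  comm' i j hij := by
    obtain rfl : i + 1 = j := hij
    rw [complex_d (ha₀ := ha₀) (ha₁ := ha₁), complex_d (ha₀ := hb₀) (ha₁ := hb₁)]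
    by_cases n0 : i = 0
    · subst n0; exact c₀
    by_cases n1 : i = 1
    · subst n1; exact c₁
    by_cases n2 : i = 2
    · subst n2; exact c₂
    by_cases n3 : i = 3
    · subst n3
      exact (isZero_X B₀ B₁ B₂ B₃ (3 + 1) (by lia) (by lia) (by lia) (by lia)).eq_of_tgt _ _
    · exact (isZero_X _ _ _ _ i n0 n1 n2 n3).eq_of_src _ _

lemma hom_ext {u v : complex a₀ a₁ a₂ ha₀ ha₁ ⟶ complex b₀ b₁ b₂ hb₀ hb₁}
    (h₀ : u.f 0 = v.f 0) (h₁ : u.f 1 = v.f 1) (h₂ : u.f 2 = v.f 2) (h₃ : u.f 3 = v.f 3) :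
    u = v := by
  ext i
  by_cases n0 : i = 0
  · subst n0; exact h₀
  by_cases n1 : i = 1
  · subst n1; exact h₁
  by_cases n2 : i = 2
  · subst n2; exact h₂
  by_cases n3 : i = 3
  · subst n3; exact h₃
  · exact (isZero_X _ _ _ _ i n0 n1 n2 n3).eq_of_src _ _

/-- The family of degree `-1` morphisms whose only component is `A₂ ⟶ B₁`. -/
noncomputable def single (h : A₂ ⟶ B₁) (i j : ℤ) :
    (complex a₀ a₁ a₂ ha₀ ha₁).X i ⟶ (complex b₀ b₁ b₂ hb₀ hb₁).X j :=
  match i with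
  | 2 => match j with
    | 1 => h
    | _ => 0
  | _ => 0

lemma single_eq_zero_of_left (h : A₂ ⟶ B₁) (i j : ℤ) (hi : i ≠ 2) :
    (single h i j : (complex a₀ a₁ a₂ ha₀ ha₁).X i ⟶ (complex b₀ b₁ b₂ hb₀ hb₁).X j) = 0 := by
  unfold single
  split
  · contradiction
  · rfl

lemma single_eq_zero_of_right (h : A₂ ⟶ B₁) (i j : ℤ) (hj : j ≠ 1) :
    (single h i j : (complex a₀ a₁ a₂ ha₀ ha₁).X i ⟶ (complex b₀ b₁ b₂ hb₀ hb₁).X j) = 0 := by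
  unfold single
  split
  · match j with
    | .ofNat 0 => rfl
    | .ofNat 1 => contradiction
    | .ofNat (n + 2) => rfl
    | .negSucc n => rfl
  · rfl

/-- A homotopy between morphisms of four-term segments concentrated in a single component
`A₂ ⟶ B₁`. -/
noncomputable def homotopy {u v : complex a₀ a₁ a₂ ha₀ ha₁ ⟶ complex b₀ b₁ b₂ hb₀ hb₁}
    (h : A₂ ⟶ B₁) (v₁ : A₁ ⟶ B₁) (v₂ : A₂ ⟶ B₂) (hv₁ : v.f 1 = v₁) (hv₂ : v.f 2 = v₂)
    (h₀ : u.f 0 = v.f 0) (h₁ : u.f 1 = a₁ ≫ h + v₁) (h₂ : u.f 2 = h ≫ b₁ + v₂)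
    (h₃ : u.f 3 = v.f 3) : Homotopy u v where
  hom := single h
  zero i j hij := by
    by_cases hi : i = 2
    · exact single_eq_zero_of_right h i j fun hj ↦ hij (by subst hi hj; rfl)
    · exact single_eq_zero_of_left h i j hi
  comm i := by
    rw [dNext_eq _ (show (ComplexShape.up ℤ).Rel i (i + 1) from rfl),
      prevD_eq _ (show (ComplexShape.up ℤ).Rel (i - 1) i from sub_add_cancel i 1)]
    by_cases n1 : i = 1
    · subst n1
      rw [single_eq_zero_of_left h (1 : ℤ) _ (by decide), zero_comp, add_zero, complex_d, hv₁]
      exact h₁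
    by_cases n2 : i = 2
    · subst n2
      rw [single_eq_zero_of_right h (2 + 1 : ℤ) _ (by decide), comp_zero, zero_add, hv₂]
      refine h₂.trans (congrArg (· + v₂) ?_)
      exact congrArg (h ≫ ·) (complex_d (ha₀ := hb₀) (ha₁ := hb₁) 1).symm
    rw [single_eq_zero_of_right h (i + 1) _ n1, single_eq_zero_of_left h i _ n2, comp_zero, zero_comp,
      zero_add, zero_add]
    by_cases n0 : i = 0
    · subst n0; exact h₀
    by_cases n3 : i = 3
    · subst n3; exact h₃
    · exact (isZero_X _ _ _ _ i n0 n1 n2 n3).eq_of_src _ _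

end

end

section

variable {𝒞 : Type*} [Category 𝒞] [Preadditive 𝒞] [HasBinaryBiproducts 𝒞]
  {C b₁ b₂ D E F : 𝒞} {α : C ⟶ b₁} {β : C ⟶ D} {φ : b₁ ⟶ b₂} {δ : D ⟶ b₂} {γ : b₁ ⟶ E}
  {ε : D ⟶ E} {μ : b₂ ⟶ F} {ν : E ⟶ F}

lemma comp_schur_eq_zero [IsIso φ]
    (h : biprod.lift α β ≫ biprod.lift (biprod.desc φ δ) (biprod.desc γ ε) = 0) :
    β ≫ (ε - δ ≫ inv φ ≫ γ) = 0 := by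
  have h₁ : α ≫ φ + β ≫ δ = 0 := by simpa using h =≫ biprod.fst
  have h₂ : α ≫ γ + β ≫ ε = 0 := by simpa using h =≫ biprod.snd
  have h₃ : β ≫ δ = -(α ≫ φ) := eq_neg_of_add_eq_zero_right h₁
  rw [Preadditive.comp_sub, reassoc_of% h₃]
  simpa [add_comm] using h₂

lemma pivot_comp_eq_zero
    (h : biprod.lift (biprod.desc φ δ) (biprod.desc γ ε) ≫ biprod.desc μ ν = 0) :
    φ ≫ μ + γ ≫ ν = 0 := by
  simpa using biprod.inl ≫= h

lemma schur_comp_eq_zero [IsIso φ]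
    (h : biprod.lift (biprod.desc φ δ) (biprod.desc γ ε) ≫ biprod.desc μ ν = 0) :
    (ε - δ ≫ inv φ ≫ γ) ≫ ν = 0 := by
  have h₂ : δ ≫ μ + ε ≫ ν = 0 := by simpa using biprod.inr ≫= h
  have h₃ : γ ≫ ν = -(φ ≫ μ) := eq_neg_of_add_eq_zero_right (pivot_comp_eq_zero h)
  simpa [h₃, add_comm] using h₂

/-- Gaussian elimination of an invertible component of the middle differential of a four-term
segment is a homotopy equivalence. -/
noncomputable def gaussianElimination [HasZeroObject 𝒞] [IsIso φ]
    (h₀ : biprod.lift α β ≫ biprod.lift (biprod.desc φ δ) (biprod.desc γ ε) = 0)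
    (h₁ : biprod.lift (biprod.desc φ δ) (biprod.desc γ ε) ≫ biprod.desc μ ν = 0) :
    HomotopyEquiv
      (complex (biprod.lift α β) (biprod.lift (biprod.desc φ δ) (biprod.desc γ ε))
        (biprod.desc μ ν) h₀ h₁)
      (complex β (ε - δ ≫ inv φ ≫ γ) ν (comp_schur_eq_zero h₀) (schur_comp_eq_zero h₁)) where
  hom := hom (𝟙 C) biprod.snd (biprod.desc (-(inv φ ≫ γ)) (𝟙 E)) (𝟙 F) (by simp)
    (by ext <;> simp [sub_eq_neg_add])
    (by
      have h₃ : γ ≫ ν = -(φ ≫ μ) := eq_neg_of_add_eq_zero_right (pivot_comp_eq_zero h₁)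
      ext <;> simp [h₃])
  inv := hom (𝟙 C) (biprod.lift (-(δ ≫ inv φ)) (𝟙 D)) biprod.inr (𝟙 F)
    (by
      have h₃ : α ≫ φ + β ≫ δ = 0 := by simpa using h₀ =≫ biprod.fst
      have h₄ : β ≫ δ = -(α ≫ φ) := eq_neg_of_add_eq_zero_right h₃
      ext <;> simp [reassoc_of% h₄])
    (by ext <;> simp [sub_eq_neg_add])
    (by simp)
  homotopyHomInvId := homotopy (-(biprod.fst ≫ inv φ ≫ biprod.inl)) (𝟙 _) (𝟙 _) rfl rfl
    (Category.comp_id (𝟙 C))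
    (show biprod.snd ≫ biprod.lift (-(δ ≫ inv φ)) (𝟙 D) =
        biprod.lift (biprod.desc φ δ) (biprod.desc γ ε) ≫
          (-(biprod.fst ≫ inv φ ≫ biprod.inl)) + 𝟙 (b₁ ⊞ D) by
      ext <;> simp)
    (show biprod.desc (-(inv φ ≫ γ)) (𝟙 E) ≫ biprod.inr =
        (-(biprod.fst ≫ inv φ ≫ biprod.inl)) ≫
          biprod.lift (biprod.desc φ δ) (biprod.desc γ ε) + 𝟙 (b₂ ⊞ E) by
      ext <;> simp)
    (Category.comp_id (𝟙 F))
  homotopyInvHomId := Homotopy.ofEq (hom_ext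
    (Category.comp_id (𝟙 C))
    (biprod.lift_snd _ _)
    (biprod.inr_desc _ _)
    (Category.comp_id (𝟙 F)))

end

end FourTermComplex

/-- **Gaussian elimination preserves block-lower-triangularity** (Proposition 2.7 of the
paper).  Given a four-term cochain complex segment
`C ⟶ b₁ ⊞ (D₁ ⊞ D₂) ⟶ b₂ ⊞ (E₁ ⊞ E₂) ⟶ F` with consecutive composites zero, whose
differentials are block-lower-triangular (`δ = (δ₁, 0)`, `ε = fromBlocks ε₁ 0 ε₂ ε₃`) and whose
pivot `φ : b₁ ⟶ b₂` is an isomorphism, the reduced segment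
`C ⟶β (D₁ ⊞ D₂) ⟶(ε - γ∘φ⁻¹∘δ) (E₁ ⊞ E₂) ⟶ν F` has consecutive composites zero, its middle
differential has zero component `D₂ → E₁` and component `D₂ → E₂` equal to `ε₃`; moreover the
four-term segment, extended by zero to a `ℤ`-indexed complex, is homotopy equivalent to the
reduced three-term segment extended by zero. -/
theorem gaussian_elimination_blockLowerTriangular
    {𝒞 : Type*} [Category 𝒞] [Preadditive 𝒞] [HasBinaryBiproducts 𝒞] [HasZeroObject 𝒞]
    (C b₁ b₂ F D₁ D₂ E₁ E₂ : 𝒞)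
    (d₀ : C ⟶ (b₁ ⊞ (D₁ ⊞ D₂))) (d₁ : (b₁ ⊞ (D₁ ⊞ D₂)) ⟶ (b₂ ⊞ (E₁ ⊞ E₂)))
    (d₂ : (b₂ ⊞ (E₁ ⊞ E₂)) ⟶ F)
    (hc₁ : d₀ ≫ d₁ = 0) (hc₂ : d₁ ≫ d₂ = 0)
    (α : C ⟶ b₁) (β : C ⟶ (D₁ ⊞ D₂))
    (φ : b₁ ⟶ b₂) (δ : (D₁ ⊞ D₂) ⟶ b₂) (γ : b₁ ⟶ (E₁ ⊞ E₂)) (ε : (D₁ ⊞ D₂) ⟶ (E₁ ⊞ E₂))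
    (δ₁ : D₁ ⟶ b₂) (ε₁ : D₁ ⟶ E₁) (ε₂ : D₁ ⟶ E₂) (ε₃ : D₂ ⟶ E₂)
    (μ : b₂ ⟶ F) (ν : (E₁ ⊞ E₂) ⟶ F)
    (hd₀ : d₀ = biprod.lift α β)
    (hd₁ : d₁ = biprod.lift (biprod.desc φ δ) (biprod.desc γ ε))
    (hd₂ : d₂ = biprod.desc μ ν)
    (hδ : δ = biprod.desc δ₁ (0 : D₂ ⟶ b₂))
    (hε : ε = biprod.lift (biprod.desc ε₁ (0 : D₂ ⟶ E₁)) (biprod.desc ε₂ ε₃))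
    [IsIso φ] :
    β ≫ (ε - δ ≫ inv φ ≫ γ) = 0 ∧
    (ε - δ ≫ inv φ ≫ γ) ≫ ν = 0 ∧
    biprod.inr ≫ (ε - δ ≫ inv φ ≫ γ) ≫ biprod.fst = (0 : D₂ ⟶ E₁) ∧
    biprod.inr ≫ (ε - δ ≫ inv φ ≫ γ) ≫ biprod.snd = ε₃ ∧
    ∃ (P Q : CochainComplex 𝒞 ℤ)
      (hP₀ : P.X 0 = C) (hP₁ : P.X 1 = (b₁ ⊞ (D₁ ⊞ D₂)))
      (hP₂ : P.X 2 = (b₂ ⊞ (E₁ ⊞ E₂))) (hP₃ : P.X 3 = F)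
      (hQ₀ : Q.X 0 = C) (hQ₁ : Q.X 1 = (D₁ ⊞ D₂))
      (hQ₂ : Q.X 2 = (E₁ ⊞ E₂)) (hQ₃ : Q.X 3 = F),
      (∀ k : ℤ, k ≠ 0 → k ≠ 1 → k ≠ 2 → k ≠ 3 → Limits.IsZero (P.X k)) ∧
      (∀ k : ℤ, k ≠ 0 → k ≠ 1 → k ≠ 2 → k ≠ 3 → Limits.IsZero (Q.X k)) ∧
      P.d 0 1 = eqToHom hP₀ ≫ d₀ ≫ eqToHom hP₁.symm ∧
      P.d 1 2 = eqToHom hP₁ ≫ d₁ ≫ eqToHom hP₂.symm ∧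
      P.d 2 3 = eqToHom hP₂ ≫ d₂ ≫ eqToHom hP₃.symm ∧
      Q.d 0 1 = eqToHom hQ₀ ≫ β ≫ eqToHom hQ₁.symm ∧
      Q.d 1 2 = eqToHom hQ₁ ≫ (ε - δ ≫ inv φ ≫ γ) ≫ eqToHom hQ₂.symm ∧
      Q.d 2 3 = eqToHom hQ₂ ≫ ν ≫ eqToHom hQ₃.symm ∧
      Nonempty (HomotopyEquiv P Q) := by
  subst hd₀ hd₁ hd₂
  have hβ := FourTermComplex.comp_schur_eq_zero hc₁
  have hν := FourTermComplex.schur_comp_eq_zero hc₂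
  refine ⟨hβ, hν, by simp [hδ, hε], by simp [hδ, hε],
    FourTermComplex.complex _ _ _ hc₁ hc₂, FourTermComplex.complex _ _ _ hβ hν,
    rfl, rfl, rfl, rfl, rfl, rfl, rfl, rfl,
    FourTermComplex.isZero_X _ _ _ _, FourTermComplex.isZero_X _ _ _ _, ?_, ?_, ?_, ?_, ?_, ?_,
    ⟨FourTermComplex.gaussianElimination hc₁ hc₂⟩⟩
  all_goals
    refine Eq.trans ?_ ((Category.id_comp _).trans (Category.comp_id _)).symm
  exacts [FourTermComplex.complex_d 0, FourTermComplex.complex_d 1, FourTermComplex.complex_d 2,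
    FourTermComplex.complex_d 0, FourTermComplex.complex_d 1, FourTermComplex.complex_d 2]
end
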